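/- Let f : ℝ^d → ℝ be differentiable and coordinate-wise L̄-smooth, μ-strongly convex with minimum value f_*. For w ∈ ℝ^d and each coordinate j ∈ {1,…,d}, let w⁺(j) = w − η_j∇_j f(w)e_j where η_j is chosen by exact coordinate line optimization, i.e. f(w⁺(j)) ≤ f(w − η∇_j f(w)e_j) for all η ∈ ℝ. Then the average over a uniformly random coordinate satisfies (1/d)∑_{j=1}^d f(w⁺(j)) ≤ f(w) − (1/(2dL̄))‖∇f(w)‖², and consequently (1/d)∑_{j=1}^d (f(w⁺(j)) − f_*) ≤ (1 − μ/(dL̄))(f(w) − f_*). -/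

import Mathlib

open scoped RealInnerProductSpace

lemma cd_descent_aux {d : ℕ}
    (f : EuclideanSpace ℝ (Fin d) → ℝ)
    (f' : EuclideanSpace ℝ (Fin d) → EuclideanSpace ℝ (Fin d))
    (L : ℝ)
    (hdiff : ∀ x, HasGradientAt f (f' x) x)
    (hsmooth : ∀ (u : EuclideanSpace ℝ (Fin d)) (j : Fin d) (α : ℝ),
      |f' (u + α • EuclideanSpace.single j (1 : ℝ)) j - f' u j| ≤ L * |α|)
    (w : EuclideanSpace ℝ (Fin d)) (j : Fin d) (s : ℝ) :
    f (w + s • EuclideanSpace.single j (1 : ℝ)) ≤ f w + s * f' w j + L / 2 * s ^ 2 := by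
  set e : EuclideanSpace ℝ (Fin d) := EuclideanSpace.single j (1 : ℝ) with he
  have hφ : ∀ t : ℝ, HasDerivAt (fun t : ℝ => f (w + (t * s) • e))
      (s * f' (w + (t * s) • e) j) t := by
    intro t
    have h1 : HasDerivAt (fun t : ℝ => w + (t * s) • e) ((1 * s) • e) t :=
      (((hasDerivAt_id t).mul_const s).smul_const e).const_add w
    have h2 := (hdiff (w + (t * s) • e)).hasFDerivAt.comp_hasDerivAt t h1
    have h3 : s * f' (w + (t * s) • e) j =
        (InnerProductSpace.toDual ℝ (EuclideanSpace ℝ (Fin d)) (f' (w + (t * s) • e)))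
          ((1 * s) • e) := by
      rw [InnerProductSpace.toDual_apply_apply, inner_smul_right, he,
        EuclideanSpace.inner_single_right]
      simp
    rw [h3]
    exact h2
  have hψ : ∀ t : ℝ, HasDerivAt
      (fun t : ℝ => f (w + (t * s) • e) - (t * (s * f' w j) + L / 2 * s ^ 2 * t ^ 2))
      (s * f' (w + (t * s) • e) j - (1 * (s * f' w j) + L / 2 * s ^ 2 * (2 * t))) t := by
    intro t
    refine (hφ t).sub (((hasDerivAt_id t).mul_const _).add ?_)
    have := (hasDerivAt_pow 2 t).const_mul (L / 2 * s ^ 2)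
    simpa using this
  have hanti : AntitoneOn
      (fun t : ℝ => f (w + (t * s) • e) - (t * (s * f' w j) + L / 2 * s ^ 2 * t ^ 2))
      (Set.Ici 0) := by
    apply antitoneOn_of_deriv_nonpos (convex_Ici 0)
    · exact fun t _ => (hψ t).continuousAt.continuousWithinAt
    · exact fun t _ => (hψ t).differentiableAt.differentiableWithinAt
    · intro t ht
      rw [interior_Ici] at ht
      have ht : 0 < t := ht
      rw [(hψ t).deriv]
      have h := hsmooth w j (t * s)
      have h3 : s * (f' (w + (t * s) • e) j - f' w j) ≤ |s| * (L * |t * s|) := by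
        refine (le_abs_self _).trans ?_
        rw [abs_mul]
        exact mul_le_mul_of_nonneg_left h (abs_nonneg _)
      rw [abs_mul, abs_of_pos ht] at h3
      have h4 : |s| * (L * (t * |s|)) = L * t * s ^ 2 := by
        rw [← sq_abs s]; ring
      rw [h4] at h3
      linarith
  have := hanti (Set.mem_Ici.2 le_rfl) (Set.mem_Ici.2 zero_le_one) zero_le_one
  simp at this
  linarith

/-- Per-iteration expected progress of randomized coordinate descent with
exact coordinate line optimization under coordinate-wise L̄-smoothness and μ-strong
convexity. -/
theorem random_cd_expected_progress {d : ℕ} (hd : 0 < d)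
    (f : EuclideanSpace ℝ (Fin d) → ℝ)
    (f' : EuclideanSpace ℝ (Fin d) → EuclideanSpace ℝ (Fin d))
    (L μ fstar : ℝ) (hL : 0 < L) (hμ : 0 < μ)
    (hdiff : ∀ x, HasGradientAt f (f' x) x)
    (hsmooth : ∀ (u : EuclideanSpace ℝ (Fin d)) (j : Fin d) (α : ℝ),
      |f' (u + α • EuclideanSpace.single j (1 : ℝ)) j - f' u j| ≤ L * |α|)
    (hsc : ∀ u v, f v ≥ f u + ⟪f' u, v - u⟫ + μ / 2 * ‖v - u‖ ^ 2)
    (hmin : ∃ wstar, f wstar = fstar ∧ ∀ x, fstar ≤ f x)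
    (w : EuclideanSpace ℝ (Fin d))
    (wplus : Fin d → EuclideanSpace ℝ (Fin d))
    (hstep : ∀ j : Fin d,
      (∃ η : ℝ, wplus j = w - (η * f' w j) • EuclideanSpace.single j (1 : ℝ)) ∧
      ∀ η : ℝ, f (wplus j) ≤ f (w - (η * f' w j) • EuclideanSpace.single j (1 : ℝ))) :
    (1 / (d : ℝ)) * ∑ j, f (wplus j) ≤ f w - 1 / (2 * d * L) * ‖f' w‖ ^ 2 ∧
    (1 / (d : ℝ)) * ∑ j, (f (wplus j) - fstar) ≤ (1 - μ / (d * L)) * (f w - fstar) := by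
  have hd' : (0 : ℝ) < d := by exact_mod_cast hd
  have hj : ∀ j, f (wplus j) ≤ f w - 1 / (2 * L) * (f' w j) ^ 2 := by
    intro j
    have h1 := (hstep j).2 (1 / L)
    have h2 := cd_descent_aux f f' L hdiff hsmooth w j (-(1 / L * f' w j))
    rw [neg_smul, ← sub_eq_add_neg] at h2
    refine h1.trans (h2.trans (le_of_eq ?_))
    field_simp
    ring
  have hnorm : ‖f' w‖ ^ 2 = ∑ j, (f' w j) ^ 2 := EuclideanSpace.real_norm_sq_eq _
  have hsum : ∑ j, f (wplus j) ≤ d * f w - 1 / (2 * L) * ‖f' w‖ ^ 2 := by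
    refine (Finset.sum_le_sum fun j _ => hj j).trans (le_of_eq ?_)
    rw [Finset.sum_sub_distrib, ← Finset.mul_sum, hnorm]
    simp
  have hA : (1 / (d : ℝ)) * ∑ j, f (wplus j) ≤ f w - 1 / (2 * d * L) * ‖f' w‖ ^ 2 := by
    refine (mul_le_mul_of_nonneg_left hsum (by positivity)).trans (le_of_eq ?_)
    field_simp
  refine ⟨hA, ?_⟩
  obtain ⟨x, hx, -⟩ := hmin
  have hpl : 2 * μ * (f w - fstar) ≤ ‖f' w‖ ^ 2 := by
    have h1 := hsc w x
    have h2 : 0 ≤ ‖f' w + μ • (x - w)‖ ^ 2 := by positivity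
    rw [norm_add_sq_real, inner_smul_right, norm_smul, mul_pow, Real.norm_eq_abs, sq_abs] at h2
    rw [hx] at h1
    have h3 := mul_le_mul_of_nonneg_left h1 hμ.le
    nlinarith
  have h5 : (1 / (d : ℝ)) * ∑ j, (f (wplus j) - fstar)
      = (1 / (d : ℝ)) * ∑ j, f (wplus j) - fstar := by
    rw [Finset.sum_sub_distrib]
    simp
    field_simp
  have h6 := mul_le_mul_of_nonneg_left hpl (show 0 ≤ 1 / (2 * d * L) by positivity)
  have h7 : 1 / (2 * d * L) * (2 * μ * (f w - fstar)) = μ / (d * L) * (f w - fstar) := by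
    field_simp
  rw [h5]
  linarith
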